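/- (Lyapunov stability equivalence) Let V be an n×m real matrix satisfying (A2), let A be an n×n real matrix, and let η be a real scalar. Then there exists an m×m matrix M with 1ᵀM = −η1ᵀ, AV = VM, and nonnegative off-diagonal entries, if and only if for every x ∈ ℝⁿ and every h ∈ ∂ψ_V(x) one has hᵀAx ≤ −η ψ_V(x). -/

import Mathlib

open Matrix Pointwise

/-- The V-representation polyhedron `C_V(V)`: the convex hull of the columns of `V`,
`{x : x = Vp, p ≥ 0, 1ᵀp = 1}`. -/
def polyV {n m : ℕ} (V : Matrix (Fin n) (Fin m) ℝ) : Set (Fin n → ℝ) :=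
  {x | ∃ p : Fin m → ℝ, (∀ i, 0 ≤ p i) ∧ (∑ i, p i) = 1 ∧ x = V.mulVec p}

/-- The gauge function `ψ_V(x) = inf {1ᵀp : x = Vp, p ≥ 0}`. -/
noncomputable def psiV {n m : ℕ} (V : Matrix (Fin n) (Fin m) ℝ) (x : Fin n → ℝ) : ℝ :=
  sInf {r : ℝ | ∃ p : Fin m → ℝ, (∀ i, 0 ≤ p i) ∧ x = V.mulVec p ∧ (∑ i, p i) = r}

/-- The subdifferential `∂ψ_V(x) = {h : ψ_V(y) − ψ_V(x) ≥ hᵀ(y − x) for all y}`. -/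
def subdiffV {n m : ℕ} (V : Matrix (Fin n) (Fin m) ℝ) (x : Fin n → ℝ) : Set (Fin n → ℝ) :=
  {h | ∀ y : Fin n → ℝ, psiV V y - psiV V x ≥ h ⬝ᵥ (y - x)}

/-- **Farkas' lemma** for finitely many linear functionals. -/
theorem exists_nonneg_sum_smul_eq_of_forall_nonpos {E ι : Type*} [AddCommGroup E] [Module ℝ E]
    (s : Finset ι) (f : ι → E →ₗ[ℝ] ℝ) (b : E →ₗ[ℝ] ℝ)
    (h : ∀ x, (∀ i ∈ s, f i x ≤ 0) → b x ≤ 0) :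
    ∃ c : ι → ℝ, (∀ i, 0 ≤ c i) ∧ b = ∑ i ∈ s, c i • f i := by
  classical
  induction s using Finset.induction_on generalizing f b with
  | empty =>
    refine ⟨0, fun _ => le_rfl, ?_⟩
    ext x
    have h₁ := h x (by simp)
    have h₂ := h (-x) (by simp)
    simp only [map_neg] at h₂
    simp only [Finset.sum_empty, LinearMap.zero_apply]
    linarith
  | insert a s ha ih =>
    by_cases hb : ∀ x, (∀ i ∈ s, f i x ≤ 0) → b x ≤ 0
    · obtain ⟨c, hc, rfl⟩ := ih f b hb
      refine ⟨Function.update c a 0, fun i => ?_, ?_⟩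
      · by_cases hi : i = a <;> simp [hi, hc]
      · rw [Finset.sum_insert ha, Function.update_self, zero_smul, zero_add]
        refine Finset.sum_congr rfl fun i hi => ?_
        rw [Function.update_of_ne (ne_of_mem_of_not_mem hi ha)]
    push Not at hb
    obtain ⟨z, hz, hbz⟩ := hb
    have haz : 0 < f a z := by
      by_contra hn
      refine absurd (h z fun i hi => ?_) (not_le.2 hbz)
      rcases Finset.mem_insert.1 hi with rfl | hi
      · exact not_lt.1 hn
      · exact hz i hi
    obtain ⟨c, hc, hbc⟩ := ih (fun i => f i - (f i z / f a z) • f a)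
      (b - (b z / f a z) • f a) (by
        intro x hx
        have key : ∀ g : E →ₗ[ℝ] ℝ, (g - (g z / f a z) • f a) x = g (x - (f a x / f a z) • z) := by
          intro g
          simp only [LinearMap.sub_apply, LinearMap.smul_apply, map_sub, map_smul, smul_eq_mul]
          ring
        rw [key]
        refine h _ fun i hi => ?_
        rcases Finset.mem_insert.1 hi with rfl | hi
        · simp [haz.ne']
        · rw [← key]
          exact hx i hi)
    refine ⟨Function.update c a (b z / f a z - ∑ i ∈ s, c i * (f i z / f a z)), fun i => ?_, ?_⟩
    · by_cases hi : i = a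
      · subst hi
        rw [Function.update_self, sub_nonneg]
        refine (Finset.sum_nonpos fun k hk => ?_).trans (div_nonneg hbz.le haz.le)
        exact mul_nonpos_of_nonneg_of_nonpos (hc k) (div_nonpos_of_nonpos_of_nonneg (hz k hk) haz.le)
      · simp [hi, hc]
    · have hs : ∑ i ∈ s, Function.update c a (b z / f a z - ∑ i ∈ s, c i * (f i z / f a z)) i • f i
          = ∑ i ∈ s, c i • f i := by
        refine Finset.sum_congr rfl fun i hi => ?_
        rw [Function.update_of_ne (ne_of_mem_of_not_mem hi ha)]
      rw [Finset.sum_insert ha, Function.update_self, hs]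
      ext x
      have hx := LinearMap.congr_fun hbc x
      simp only [LinearMap.sub_apply, LinearMap.smul_apply, LinearMap.sum_apply, smul_eq_mul,
        mul_sub, Finset.sum_sub_distrib, ← mul_assoc, ← Finset.sum_mul] at hx
      simp only [LinearMap.add_apply, LinearMap.smul_apply, LinearMap.sum_apply, smul_eq_mul,
        sub_mul]
      linarith

/-- The linear functional `(g, s) ↦ gᵀv - c s`. -/
def dotSub {n : ℕ} (v : Fin n → ℝ) (c : ℝ) : ((Fin n → ℝ) × ℝ) →ₗ[ℝ] ℝ where
  toFun z := z.1 ⬝ᵥ v - c * z.2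
  map_add' y z := by simp only [Prod.fst_add, Prod.snd_add, add_dotProduct]; ring
  map_smul' r z := by
    simp only [Prod.smul_fst, Prod.smul_snd, smul_dotProduct, smul_eq_mul, RingHom.id_apply]; ring

section Gauge

variable {n m : ℕ} {V : Matrix (Fin n) (Fin m) ℝ}

theorem psiV_mulVec_le {p : Fin m → ℝ} (hp : ∀ i, 0 ≤ p i) : psiV V (V *ᵥ p) ≤ ∑ i, p i :=
  csInf_le ⟨0, by rintro _ ⟨q, hq, -, rfl⟩; exact Finset.sum_nonneg fun i _ => hq i⟩
    ⟨p, hp, rfl, rfl⟩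

theorem exists_pos_smul_mem_polyV (hV : (0 : Fin n → ℝ) ∈ interior (polyV V)) (x : Fin n → ℝ) :
    ∃ t : ℝ, 0 < t ∧ t • x ∈ polyV V := by
  have hc : Filter.Tendsto (fun t : ℝ => t • x) (nhdsWithin 0 (Set.Ioi 0)) (nhds 0) := by
    have : Continuous fun t : ℝ => t • x := by fun_prop
    simpa using (this.tendsto 0).mono_left nhdsWithin_le_nhds
  have h := hc.eventually (mem_interior_iff_mem_nhds.1 hV)
  obtain ⟨t, ht, ht'⟩ := (h.and self_mem_nhdsWithin).exists
  exact ⟨t, ht', ht⟩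

theorem le_psiV (hV : (0 : Fin n → ℝ) ∈ interior (polyV V)) {x : Fin n → ℝ} {c : ℝ}
    (h : ∀ p : Fin m → ℝ, (∀ i, 0 ≤ p i) → x = V *ᵥ p → c ≤ ∑ i, p i) : c ≤ psiV V x := by
  refine le_csInf ?_ ?_
  · obtain ⟨t, ht, p, hp, -, hx⟩ := exists_pos_smul_mem_polyV hV x
    refine ⟨_, t⁻¹ • p, fun i => mul_nonneg (inv_nonneg.2 ht.le) (hp i), ?_, rfl⟩
    rw [mulVec_smul, ← hx, smul_smul, inv_mul_cancel₀ ht.ne', one_smul]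
  · rintro _ ⟨p, hp, hx, rfl⟩
    exact h p hp hx

theorem dotProduct_mulVec_le_mul_sum {g : Fin n → ℝ} {s : ℝ} (hg : ∀ i, g ⬝ᵥ V.col i ≤ s)
    {p : Fin m → ℝ} (hp : ∀ i, 0 ≤ p i) : g ⬝ᵥ V *ᵥ p ≤ s * ∑ i, p i := by
  rw [dotProduct_mulVec, Finset.mul_sum]
  exact Finset.sum_le_sum fun i _ => mul_le_mul_of_nonneg_right (hg i) (hp i)

theorem mem_subdiffV_col (hV : (0 : Fin n → ℝ) ∈ interior (polyV V)) {h : Fin n → ℝ} {j : Fin m}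
    (hh : ∀ i, h ⬝ᵥ V.col i ≤ 1) (hj : h ⬝ᵥ V.col j = 1) :
    h ∈ subdiffV V (V.col j) ∧ psiV V (V.col j) = 1 := by
  have hle : ∀ y, h ⬝ᵥ y ≤ psiV V y := fun y => le_psiV hV fun p hp hy => by
    simpa [hy] using dotProduct_mulVec_le_mul_sum hh hp
  have hpsi : psiV V (V.col j) = 1 := by
    refine le_antisymm ?_ (hj ▸ hle _)
    have := psiV_mulVec_le (V := V) (p := Pi.single j 1) fun i => by
      by_cases hi : i = j
      · subst hi; simp
      · simp [hi]
    simpa using this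
  refine ⟨fun y => ?_, hpsi⟩
  rw [dotProduct_sub, hj, hpsi]
  linarith [hle y]

theorem dotProduct_mulVec_le_of_metzler (hV : (0 : Fin n → ℝ) ∈ interior (polyV V))
    {A : Matrix (Fin n) (Fin n) ℝ} {η : ℝ} {M : Matrix (Fin m) (Fin m) ℝ}
    (hsum : ∀ j, ∑ i, M i j = -η) (hM : A * V = V * M) (hoff : ∀ i j, i ≠ j → 0 ≤ M i j)
    {x h : Fin n → ℝ} (hh : h ∈ subdiffV V x) : h ⬝ᵥ A *ᵥ x ≤ -η * psiV V x := by
  obtain ⟨t, ht, htη, htM⟩ : ∃ t : ℝ, 0 < t ∧ 0 < 1 - t * η ∧ ∀ i, 0 ≤ 1 + t * M i i := by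
    have hD : 0 ≤ ∑ i, |M i i| := Finset.sum_nonneg fun i _ => abs_nonneg _
    have hpos : 0 < 1 + |η| + ∑ i, |M i i| := by positivity
    refine ⟨(1 + |η| + ∑ i, |M i i|)⁻¹, inv_pos.2 hpos, ?_, fun i => ?_⟩
    · rw [sub_pos, inv_mul_lt_iff₀ hpos]
      linarith [le_abs_self η]
    · have h₁ : |M i i| ≤ ∑ i, |M i i| :=
        Finset.single_le_sum (f := fun i => |M i i|) (fun i _ => abs_nonneg _) (Finset.mem_univ i)
      rw [← neg_le_iff_add_nonneg', neg_le, ← mul_neg, inv_mul_le_iff₀ hpos]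
      linarith [neg_le_abs (M i i), abs_nonneg η]
  have hle : psiV V (x + t • A *ᵥ x) / (1 - t * η) ≤ psiV V x := by
    refine le_psiV hV fun p hp hx => ?_
    rw [div_le_iff₀ htη]
    have hq : ∀ i, 0 ≤ (p + t • M *ᵥ p) i := fun i => by
      have h₁ : M i i * p i ≤ (M *ᵥ p) i := by
        rw [mulVec, dotProduct, ← Finset.add_sum_erase _ _ (Finset.mem_univ i)]
        exact le_add_of_nonneg_right (Finset.sum_nonneg fun k hk =>
          mul_nonneg (hoff i k (Finset.ne_of_mem_erase hk).symm) (hp k))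
      have h₂ := mul_le_mul_of_nonneg_left h₁ ht.le
      have h₃ := mul_nonneg (htM i) (hp i)
      simp only [Pi.add_apply, Pi.smul_apply, smul_eq_mul]
      linarith
    have hMp : ∑ i, (M *ᵥ p) i = -η * ∑ i, p i := by
      simp only [mulVec, dotProduct]
      rw [Finset.sum_comm, Finset.mul_sum]
      exact Finset.sum_congr rfl fun j _ => by rw [← Finset.sum_mul, hsum]
    have h₄ := psiV_mulVec_le (V := V) hq
    rw [mulVec_add, mulVec_smul, mulVec_mulVec, ← hM, ← mulVec_mulVec, ← hx] at h₄
    refine h₄.trans_eq ?_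
    simp only [Pi.add_apply, Pi.smul_apply, smul_eq_mul, Finset.sum_add_distrib, ← Finset.mul_sum,
      hMp]
    ring
  rw [div_le_iff₀ htη] at hle
  have h₅ := hh (x + t • A *ᵥ x)
  rw [add_sub_cancel_left, dotProduct_smul, smul_eq_mul] at h₅
  refine le_of_mul_le_mul_left ?_ ht
  linarith

theorem exists_metzler_col (hV : (0 : Fin n → ℝ) ∈ interior (polyV V))
    {A : Matrix (Fin n) (Fin n) ℝ} {η : ℝ}
    (hA : ∀ x : Fin n → ℝ, ∀ h ∈ subdiffV V x, h ⬝ᵥ A *ᵥ x ≤ -η * psiV V x) (j : Fin m) :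
    ∃ q : Fin m → ℝ, ∑ i, q i = -η ∧ A *ᵥ V.col j = V *ᵥ q ∧ ∀ i, i ≠ j → 0 ≤ q i := by
  obtain ⟨c, hc, hb⟩ := exists_nonneg_sum_smul_eq_of_forall_nonpos Finset.univ
    (fun o : Option (Fin m) => o.elim (-dotSub (V.col j) 1) fun i => dotSub (V.col i) 1)
    (dotSub (A *ᵥ V.col j) (-η)) (by
      rintro ⟨g, s⟩ hgs
      have hg : ∀ i, g ⬝ᵥ V.col i ≤ s := fun i => by
        simpa [dotSub] using hgs (some i) (Finset.mem_univ _)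
      have hj : g ⬝ᵥ V.col j = s := le_antisymm (hg j) (by
        simpa [dotSub] using hgs none (Finset.mem_univ _))
      have hpoly : ∀ y ∈ polyV V, g ⬝ᵥ y ≤ s := by
        rintro _ ⟨p, hp, hp1, rfl⟩
        simpa [hp1] using dotProduct_mulVec_le_mul_sum hg hp
      have hs : 0 ≤ s := by simpa using hpoly 0 (interior_subset hV)
      change g ⬝ᵥ A *ᵥ V.col j - -η * s ≤ 0
      rcases hs.eq_or_lt with rfl | hs
      · obtain ⟨t, ht, hmem⟩ := exists_pos_smul_mem_polyV hV (A *ᵥ V.col j)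
        have := hpoly _ hmem
        rw [dotProduct_smul, smul_eq_mul] at this
        have := nonpos_of_mul_nonpos_right this ht
        linarith
      · obtain ⟨hmem, hpsi⟩ := mem_subdiffV_col hV (h := s⁻¹ • g) (j := j)
          (fun i => by
            rw [smul_dotProduct, smul_eq_mul, inv_mul_le_iff₀ hs, mul_one]
            exact hg i)
          (by rw [smul_dotProduct, hj, smul_eq_mul, inv_mul_cancel₀ hs.ne'])
        have := hA _ _ hmem
        rw [hpsi, smul_dotProduct, smul_eq_mul, inv_mul_le_iff₀ hs] at this
        linarith)
  rw [Fintype.sum_option] at hb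
  refine ⟨(fun i => c (some i)) - Pi.single j (c none), ?_, ?_, fun i hi => ?_⟩
  · have := LinearMap.congr_fun hb (0, 1)
    simp [dotSub] at this
    simp [Finset.sum_sub_distrib]
    linarith
  · ext k
    have := LinearMap.congr_fun hb (Pi.single k 1, 0)
    simp [dotSub] at this
    rw [this, mulVec_sub]
    simp [mulVec, dotProduct, mul_comm]
    ring
  · simpa [hi] using hc (some i)

end Gauge

theorem stmt11 {n m : ℕ} (V : Matrix (Fin n) (Fin m) ℝ)
    (hV : (0 : Fin n → ℝ) ∈ interior (polyV V)) (A : Matrix (Fin n) (Fin n) ℝ) (η : ℝ) :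
    (∃ M : Matrix (Fin m) (Fin m) ℝ,
      (∀ j, ∑ i, M i j = -η) ∧ A * V = V * M ∧ (∀ i j, i ≠ j → 0 ≤ M i j)) ↔
    (∀ x : Fin n → ℝ, ∀ h ∈ subdiffV V x, h ⬝ᵥ A.mulVec x ≤ -η * psiV V x) := by
  constructor
  · rintro ⟨M, hsum, hM, hoff⟩ x h hh
    exact dotProduct_mulVec_le_of_metzler hV hsum hM hoff hh
  · intro hA
    choose q hsum hq hoff using exists_metzler_col hV hA
    refine ⟨Matrix.of fun i j => q j i, hsum, ?_, fun i j hij => hoff j i hij⟩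
    ext k j
    exact congrFun (hq j) k
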